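/- arXiv:1807.01641 — 3 statements merged into one kernel-verified Lean document; each statement's English description precedes it below -/
import Mathlib

section
/- Let (M,ω,H) be a multi-Hamiltonian system with ω an n-plectic form. If α ∈ Ω^{n−k}_Ham(M) is a locally (respectively globally) conserved quantity, then every Hamiltonian k-vector field X_α of α is a local (respectively global) continuous symmetry. Conversely, if X is a local (respectively global) continuous symmetry of degree k, then every Hamiltonian (n−k)-form α with dα = −X⌟ω is a locally (respectively globally) conserved quantity. -/
/-- An abstract model of the graded algebra of differential forms and of
multivector fields on a smooth manifold, together with an `n`-plectic form `ω`:
a closed `(n+1)`-form which is nondegenerate in the sense that `v ↦ v⌟ω` is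
injective on vector fields.  Homogeneous degrees are recorded by the
submodule-valued maps `formDeg` and `mvDeg`; `d` is the exterior differential,
`hook X τ` is the interior product `X⌟τ` (for a decomposable
`X = X₁∧⋯∧X_k` it is `X_k⌟⋯⌟X₁⌟τ`), and `schouten` is the Schouten bracket
of multivector fields.  The structure fields record the standard properties of
these operations used in multisymplectic geometry. -/
structure PlecticCtx (n : ℤ) where
  Form : Type
  [formAddCommGroup : AddCommGroup Form]
  [formModule : Module ℝ Form]
  MV : Type
  [mvAddCommGroup : AddCommGroup MV]
  [mvModule : Module ℝ MV]
  formDeg : ℤ → Submodule ℝ Form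
  mvDeg : ℤ → Submodule ℝ MV
  d : Form →ₗ[ℝ] Form
  hook : MV →ₗ[ℝ] Form →ₗ[ℝ] Form
  schouten : MV → MV → MV
  ω : Form
  d_d : ∀ τ, d (d τ) = 0
  d_deg : ∀ {i : ℤ} {τ}, τ ∈ formDeg i → d τ ∈ formDeg (i + 1)
  hook_deg : ∀ {k i : ℤ} {X τ}, X ∈ mvDeg k → τ ∈ formDeg i → hook X τ ∈ formDeg (i - k)
  schouten_deg : ∀ {k l : ℤ} {X Y}, X ∈ mvDeg k → Y ∈ mvDeg l →
    schouten X Y ∈ mvDeg (k + l - 1)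
  hook_comm : ∀ {k l : ℤ} {X Y} (τ : Form), X ∈ mvDeg k → Y ∈ mvDeg l →
    hook Y (hook X τ) = ((-1 : ℝ) ^ (k * l)) • hook X (hook Y τ)
  hook_schouten : ∀ {k l : ℤ} {X Y} (τ : Form), X ∈ mvDeg k → Y ∈ mvDeg l →
    hook (schouten X Y) τ =
      - hook Y (d (hook X τ)) + ((-1 : ℝ) ^ l) • d (hook Y (hook X τ))
        + ((-1 : ℝ) ^ (k * l + k)) • hook X (hook Y (d τ))
        - ((-1 : ℝ) ^ (k * l + k + l)) • hook X (d (hook Y τ))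
  omega_deg : ω ∈ formDeg (n + 1)
  omega_closed : d ω = 0
  omega_nondeg : ∀ {v}, v ∈ mvDeg 1 → hook v ω = 0 → v = 0

namespace PlecticCtx

attribute [instance] formAddCommGroup formModule mvAddCommGroup mvModule

variable {n : ℤ} (C : PlecticCtx n)

/-- The Lie derivative of a form along a `k`-vector field:
`L_X τ = d(X⌟τ) − (−1)^k X⌟dτ`. -/
noncomputable def lieD (k : ℤ) (X : C.MV) (τ : C.Form) : C.Form :=
  C.d (C.hook X τ) - ((-1 : ℝ) ^ k) • C.hook X (C.d τ)

/-- A closed form. -/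
def IsClosed (τ : C.Form) : Prop := C.d τ = 0

/-- An exact form. -/
def IsExact (τ : C.Form) : Prop := ∃ σ, C.d σ = τ

/-- `α` is a Hamiltonian `(n−k)`-form with (corresponding) Hamiltonian
`k`-vector field `X`, i.e. `dα = −X⌟ω`. -/
def IsHamPair (k : ℤ) (α : C.Form) (X : C.MV) : Prop :=
  α ∈ C.formDeg (n - k) ∧ X ∈ C.mvDeg k ∧ C.d α = - C.hook X C.ω

/-- `α ∈ Ω^{n−k}_Ham(M)`: a Hamiltonian `(n−k)`-form. -/
def IsHamForm (k : ℤ) (α : C.Form) : Prop := ∃ X, C.IsHamPair k α X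

/-- `X ∈ 𝔛^k_Ham(M)`: a Hamiltonian `k`-vector field, i.e. `X⌟ω` is exact. -/
def IsHamMV (k : ℤ) (X : C.MV) : Prop :=
  X ∈ C.mvDeg k ∧ ∃ α, α ∈ C.formDeg (n - k) ∧ C.d α = - C.hook X C.ω

/-- The generalized Poisson bracket `{α, β} = (−1)^{l+1} X_β⌟X_α⌟ω`, expressed
through chosen Hamiltonian multivector fields `Xα`, `Xβ` of `α ∈ Ω^{n−k}_Ham`
and `β ∈ Ω^{n−l}_Ham`. -/
noncomputable def pois (l : ℤ) (Xα Xβ : C.MV) : C.Form :=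
  ((-1 : ℝ) ^ (l + 1)) • C.hook Xβ (C.hook Xα C.ω)

end PlecticCtx

namespace PlecticCtx

/-- For Hamiltonian pairs `(α, X)` and `(β, Y)` of degrees `k` and `1`, the Lie derivatives
`L_Y α` and `L_X β` agree up to sign and an exact form. -/
theorem lieD_add_lieD_of_isHamPair {n : ℤ} (C : PlecticCtx n) {k : ℤ}
    {α β : C.Form} {X Y : C.MV} (hβ : C.IsHamPair 1 β Y) (hα : C.IsHamPair k α X) :
    C.lieD 1 Y α + C.lieD k X β = C.d (C.hook Y α + C.hook X β) := by
  have hcomm := C.hook_comm C.ω hα.2.1 hβ.2.1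
  rw [mul_one] at hcomm
  simp only [lieD, hα.2.2, hβ.2.2, map_neg, map_add, zpow_one, hcomm]
  module

theorem isHamMV_of_isHamPair {n : ℤ} (C : PlecticCtx n) {k : ℤ} {α : C.Form} {X : C.MV}
    (h : C.IsHamPair k α X) : C.IsHamMV k X :=
  ⟨h.2.1, α, h.1, h.2.2⟩

theorem isClosed_iff_of_add_eq_d {n : ℤ} (C : PlecticCtx n) {σ τ ρ : C.Form}
    (h : σ + τ = C.d ρ) : C.IsClosed σ ↔ C.IsClosed τ := by
  have hd : C.d σ + C.d τ = 0 := by rw [← map_add, h, C.d_d]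
  unfold IsClosed
  constructor <;> intro h₀ <;> simpa [h₀] using hd

theorem isExact_iff_of_add_eq_d {n : ℤ} (C : PlecticCtx n) {σ τ ρ : C.Form}
    (h : σ + τ = C.d ρ) : C.IsExact σ ↔ C.IsExact τ := by
  constructor
  · rintro ⟨μ, rfl⟩
    exact ⟨ρ - μ, by rw [map_sub, ← h, add_sub_cancel_left]⟩
  · rintro ⟨μ, rfl⟩
    exact ⟨ρ - μ, by rw [map_sub, ← h, add_sub_cancel_right]⟩

end PlecticCtx

/-- **Noether's theorem in multisymplectic geometry.**
Let `(M, ω, H)` be a multi-Hamiltonian system with `ω` an `n`-plectic form.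
If `α ∈ Ω^{n−k}_Ham(M)` is a locally (resp. globally) conserved quantity, then
every Hamiltonian `k`-vector field `X` of `α` is a local (resp. global)
continuous symmetry; conversely, if `X` is a local (resp. global) continuous
symmetry of degree `k`, then every Hamiltonian `(n−k)`-form `α` with
`dα = −X⌟ω` is a locally (resp. globally) conserved quantity. -/
theorem noether_multisymplectic {n : ℤ} (C : PlecticCtx n) (k : ℤ)
    (H : C.Form) (XH : C.MV) (hH : C.IsHamPair 1 H XH) :
    ((∀ α X, C.IsHamPair k α X → C.IsClosed (C.lieD 1 XH α) →
        C.IsHamMV k X ∧ C.IsClosed (C.lieD k X H)) ∧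
      (∀ α X, C.IsHamPair k α X → C.IsExact (C.lieD 1 XH α) →
        C.IsHamMV k X ∧ C.IsExact (C.lieD k X H))) ∧
    ((∀ X, C.IsHamMV k X → C.IsClosed (C.lieD k X H) →
        ∀ α, C.IsHamPair k α X → C.IsClosed (C.lieD 1 XH α)) ∧
      (∀ X, C.IsHamMV k X → C.IsExact (C.lieD k X H) →
        ∀ α, C.IsHamPair k α X → C.IsExact (C.lieD 1 XH α))) := by
  exact ⟨⟨fun α X h hc => ⟨C.isHamMV_of_isHamPair h,
        (C.isClosed_iff_of_add_eq_d (C.lieD_add_lieD_of_isHamPair hH h)).1 hc⟩,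
      fun α X h he => ⟨C.isHamMV_of_isHamPair h,
        (C.isExact_iff_of_add_eq_d (C.lieD_add_lieD_of_isHamPair hH h)).1 he⟩⟩,
    fun X _ hc α h => (C.isClosed_iff_of_add_eq_d (C.lieD_add_lieD_of_isHamPair hH h)).2 hc,
    fun X _ he α h => (C.isExact_iff_of_add_eq_d (C.lieD_add_lieD_of_isHamPair hH h)).2 he⟩
end

section
/- Let (M,ω,H) be a multi-Hamiltonian system. If α ∈ Ω^{n−k}_Ham(M) and β ∈ Ω^{n−l}_Ham(M) are (locally, globally or strictly) conserved quantities, then their generalized Poisson bracket {α,β} is strictly conserved: L_{X_H}{α,β} = 0. -/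
namespace PlecticCtx

variable {n : ℤ} (C : PlecticCtx n)

/-- Along a vector field the Lie derivative is given by Cartan's formula. -/
theorem lieD_one (X : C.MV) (τ : C.Form) :
    C.lieD 1 X τ = C.d (C.hook X τ) + C.hook X (C.d τ) := by
  simp [lieD]

/-- The Lie derivative along a vector field `Y` and the interior product with a multivector
field `X` commute up to the interior product with the Schouten bracket. -/
theorem hook_schouten_eq_sub_lieD {k : ℤ} {X Y : C.MV} (hX : X ∈ C.mvDeg k) (hY : Y ∈ C.mvDeg 1)
    (τ : C.Form) :
    C.hook (C.schouten X Y) τ = C.hook X (C.lieD 1 Y τ) - C.lieD 1 Y (C.hook X τ) := by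
  have hk : (-1 : ℝ) ^ (k + k) = 1 := Even.neg_one_zpow ⟨k, rfl⟩
  have hk' : (-1 : ℝ) ^ (k + k + 1) = -1 := Odd.neg_one_zpow ⟨k, by ring⟩
  rw [C.hook_schouten τ hX hY, C.lieD_one, C.lieD_one, map_add, mul_one, hk, hk', zpow_one]
  module

variable {C}

/-- The contraction of `ω` with a Hamiltonian multivector field is closed. -/
theorem IsHamPair.d_hook_omega {k : ℤ} {α : C.Form} {X : C.MV} (h : C.IsHamPair k α X) :
    C.d (C.hook X C.ω) = 0 := by
  rw [← neg_eq_zero, ← map_neg, ← h.2.2, C.d_d]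

/-- A Hamiltonian vector field preserves `ω`. -/
theorem IsHamPair.lieD_omega {H : C.Form} {Y : C.MV} (h : C.IsHamPair 1 H Y) :
    C.lieD 1 Y C.ω = 0 := by
  rw [C.lieD_one, h.d_hook_omega, C.omega_closed, map_zero, add_zero]

/-- If `α` is locally conserved along `Y`, then `Y` preserves `X_α⌟ω`. -/
theorem IsHamPair.lieD_hook_omega {k : ℤ} {α : C.Form} {X Y : C.MV} (h : C.IsHamPair k α X)
    (hc : C.IsClosed (C.lieD 1 Y α)) : C.lieD 1 Y (C.hook X C.ω) = 0 := by
  rw [IsClosed, C.lieD_one, map_add, C.d_d, zero_add, h.2.2, map_neg, map_neg, neg_eq_zero] at hc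
  rw [C.lieD_one, hc, h.d_hook_omega, map_zero, add_zero]

end PlecticCtx


/-- **The bracket of two conserved quantities is strictly conserved.**
Let `(M, ω, H)` be a multi-Hamiltonian system.  If `α ∈ Ω^{n−k}_Ham(M)` and
`β ∈ Ω^{n−l}_Ham(M)` are (locally, globally or strictly) conserved
quantities — the hypothesis below is that they are at least locally conserved,
which is implied by the global and strict cases — then their generalized
Poisson bracket `{α, β}` is strictly conserved: `L_{X_H} {α, β} = 0`. -/
theorem bracket_of_conserved_is_strictly_conserved {n : ℤ} (C : PlecticCtx n)
    (H : C.Form) (XH : C.MV) (hH : C.IsHamPair 1 H XH) (k l : ℤ)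
    (α β : C.Form) (Xα Xβ : C.MV)
    (hα : C.IsHamPair k α Xα) (hβ : C.IsHamPair l β Xβ)
    (hcα : C.IsClosed (C.lieD 1 XH α)) (hcβ : C.IsClosed (C.lieD 1 XH β)) :
    C.lieD 1 XH (C.pois l Xα Xβ) = 0 := by
  obtain ⟨-, hXH, -⟩ := id hH
  obtain ⟨-, hXα, -⟩ := id hα
  obtain ⟨-, hXβ, -⟩ := id hβ
  have hS : C.hook (C.schouten Xβ XH) C.ω = 0 := by
    rw [C.hook_schouten_eq_sub_lieD hXβ hXH, hH.lieD_omega, hβ.lieD_hook_omega hcβ, map_zero,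
      sub_zero]
  have hSα : C.hook (C.schouten Xβ XH) (C.hook Xα C.ω) = 0 := by
    rw [C.hook_comm C.ω hXα (C.schouten_deg hXβ hXH), hS, map_zero, smul_zero]
  have hL : C.lieD 1 XH (C.hook Xβ (C.hook Xα C.ω)) = 0 := by
    rwa [C.hook_schouten_eq_sub_lieD hXβ hXH, hα.lieD_hook_omega hcα, map_zero, zero_sub,
      neg_eq_zero] at hSα
  rw [C.lieD_one] at hL
  rw [PlecticCtx.pois, C.lieD_one]
  simp only [map_smul]
  rw [← smul_add, hL, smul_zero]
end

section
/- Let a connected Lie group G act multisymplectically on an n-plectic manifold (M,ω), let f_k be a weak k-moment map, and define σ_k : G → Ρ*_{g,k} ⊗ Ω^{n−k}_cl(M) by σ_k(g)(p) := f_k(p) − Φ_{g^{-1}}^* f_k(Ad_{g^{-1}} p). Then σ_k is a 1-cocycle for the differentiable group cohomology of G with coefficients in Ρ*_{g,k} ⊗ Ω^{n−k}_cl(M): σ_k(gh) = σ_k(g) + g·σ_k(h) for all g, h ∈ G, where the G-action on coefficients is (g·α)(p) = Φ_{g^{-1}}^*(α(Ad_{g^{-1}} p)). -/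
/-- An abstract model of a multisymplectic action of a connected Lie group `G`
on the `n`-plectic manifold `(M,ω)`: it records the exterior algebra `Λ•𝔤` of
the Lie algebra `𝔤` of `G` (with homogeneous degrees given by `lamDeg`), the
Lie algebra homology (Chevalley–Eilenberg) differential `∂ = bdry`, the
Schouten bracket `gbr` on `Λ•𝔤`, the infinitesimal-generator map
`p ↦ V_p` (for `p = ξ₁∧⋯∧ξ_k`, `V_p = V_{ξ₁}∧⋯∧V_{ξ_k}`), the pullback
actions `Φ_g^*` on forms and on multivector fields, and the extended adjoint
action `Ad_g` on `Λ•𝔤`, together with their standard properties.  The action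
is multisymplectic: `L_{V_ξ} ω = 0` for all `ξ ∈ 𝔤`. -/
structure PlecticAction (n : ℤ) extends PlecticCtx n where
  G : Type
  [grp : Group G]
  Λg : Type
  [lamAddCommGroup : AddCommGroup Λg]
  [lamModule : Module ℝ Λg]
  lamDeg : ℤ → Submodule ℝ Λg
  bdry : Λg →ₗ[ℝ] Λg
  gbr : Λg → Λg → Λg
  V : Λg →ₗ[ℝ] MV
  pullForm : G → Form →ₗ[ℝ] Form
  pullMV : G → MV →ₗ[ℝ] MV
  AdΛ : G → Λg →ₗ[ℝ] Λg
  bdry_bdry : ∀ p, bdry (bdry p) = 0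
  bdry_deg : ∀ {k : ℤ} {p}, p ∈ lamDeg k → bdry p ∈ lamDeg (k - 1)
  bdry_deg_one : ∀ {p}, p ∈ lamDeg 1 → bdry p = 0
  gbr_deg : ∀ {k l : ℤ} {p q}, p ∈ lamDeg k → q ∈ lamDeg l → gbr p q ∈ lamDeg (k + l - 1)
  gbr_ker : ∀ {p q}, bdry p = 0 → bdry q = 0 → bdry (gbr p q) = 0
  gbr_jacobi : ∀ {ξ η}, ξ ∈ lamDeg 1 → η ∈ lamDeg 1 → ∀ p,
    gbr (gbr ξ η) p = gbr ξ (gbr η p) - gbr η (gbr ξ p)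
  V_deg : ∀ {k : ℤ} {p}, p ∈ lamDeg k → V p ∈ mvDeg k
  V_gbr : ∀ p q, V (gbr p q) = - schouten (V p) (V q)
  multisymp : ∀ {ξ}, ξ ∈ lamDeg 1 → d (hook (V ξ) ω) + hook (V ξ) (d ω) = 0
  pullForm_one : ∀ τ, pullForm 1 τ = τ
  pullForm_mul : ∀ g h τ, pullForm (g * h) τ = pullForm h (pullForm g τ)
  pullForm_d : ∀ g τ, pullForm g (d τ) = d (pullForm g τ)
  pullForm_omega : ∀ g, pullForm g ω = ω
  pullForm_deg : ∀ (g) {i : ℤ} {τ}, τ ∈ formDeg i → pullForm g τ ∈ formDeg i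
  pull_hook : ∀ g X τ, pullForm g (hook X τ) = hook (pullMV g X) (pullForm g τ)
  AdΛ_one : ∀ p, AdΛ 1 p = p
  AdΛ_mul : ∀ g h p, AdΛ (g * h) p = AdΛ g (AdΛ h p)
  AdΛ_deg : ∀ (g) {k : ℤ} {p}, p ∈ lamDeg k → AdΛ g p ∈ lamDeg k
  AdΛ_ker : ∀ (g) {p}, bdry p = 0 → bdry (AdΛ g p) = 0
  V_Ad : ∀ g p, V (AdΛ g p) = pullMV g⁻¹ (V p)

/-- The sign `ζ(k) = −(−1)^{k(k+1)/2}`. -/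
noncomputable def zeta (k : ℤ) : ℝ := -((-1 : ℝ) ^ (k * (k + 1) / 2))

namespace PlecticAction

attribute [instance] grp lamAddCommGroup lamModule

variable {n : ℤ}

/-- The Lie derivative, inherited from the underlying `PlecticCtx`. -/
noncomputable abbrev lieD (C : PlecticAction n) (k : ℤ) (X : C.MV) (τ : C.Form) : C.Form :=
  C.toPlecticCtx.lieD k X τ

/-- The generalized Poisson bracket, inherited from the underlying `PlecticCtx`. -/
noncomputable abbrev pois (C : PlecticAction n) (l : ℤ) (Xα Xβ : C.MV) : C.Form :=
  C.toPlecticCtx.pois l Xα Xβ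

/-- Closed forms, inherited from the underlying `PlecticCtx`. -/
abbrev IsClosed (C : PlecticAction n) (τ : C.Form) : Prop := C.toPlecticCtx.IsClosed τ

/-- The `k`-th Lie kernel `Ρ_{𝔤,k} = ker ∂_k ⊆ Λ^k 𝔤`. -/
def LieKer (C : PlecticAction n) (k : ℤ) : Submodule ℝ C.Λg :=
  C.lamDeg k ⊓ LinearMap.ker C.bdry

/-- The Schouten bracket `[ξ, p]` of `ξ ∈ 𝔤` with an element `p` of the `k`-th
Lie kernel lands again in the `k`-th Lie kernel. -/
def adKer (C : PlecticAction n) (k : ℤ) (ξ : C.Λg) (hξ : ξ ∈ C.lamDeg 1)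
    (p : ↥(C.LieKer k)) : ↥(C.LieKer k) :=
  ⟨C.gbr ξ (p : C.Λg), by
    obtain ⟨hp1, hp2⟩ := Submodule.mem_inf.mp p.2
    have h1 := C.gbr_deg hξ hp1
    rw [show (1 : ℤ) + k - 1 = k by omega] at h1
    exact Submodule.mem_inf.mpr ⟨h1,
      LinearMap.mem_ker.mpr (C.gbr_ker (C.bdry_deg_one hξ) (LinearMap.mem_ker.mp hp2))⟩⟩

/-- The extended adjoint action `Ad_g` preserves the `k`-th Lie kernel. -/
def adAd (C : PlecticAction n) (g : C.G) (k : ℤ) (p : ↥(C.LieKer k)) : ↥(C.LieKer k) :=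
  ⟨C.AdΛ g (p : C.Λg), by
    obtain ⟨hp1, hp2⟩ := Submodule.mem_inf.mp p.2
    exact Submodule.mem_inf.mpr ⟨C.AdΛ_deg g hp1,
      LinearMap.mem_ker.mpr (C.AdΛ_ker g (LinearMap.mem_ker.mp hp2))⟩⟩

/-- A weak (homotopy) `k`-moment map: a linear map
`f_k : Ρ_{𝔤,k} → Ω^{n−k}_Ham(M)` with `d f_k(p) = −ζ(k) V_p⌟ω`. -/
structure WeakMomentMap (C : PlecticAction n) (k : ℤ) where
  f : ↥(C.LieKer k) →ₗ[ℝ] C.Form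
  deg : ∀ p, f p ∈ C.formDeg (n - k)
  moment : ∀ p : ↥(C.LieKer k), C.d (f p) = (-(zeta k)) • C.hook (C.V (p : C.Λg)) C.ω

/-- Equivariance of a weak `k`-moment map:
`f_k(Ad_{g⁻¹} p) = Φ_g^* f_k(p)` for all `g ∈ G` and `p ∈ Ρ_{𝔤,k}`. -/
def IsEquivariant {C : PlecticAction n} {k : ℤ} (F : WeakMomentMap C k) : Prop :=
  ∀ (g : C.G) (p : ↥(C.LieKer k)), F.f (adAd C g⁻¹ k p) = C.pullForm g (F.f p)

end PlecticAction
namespace PlecticAction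

/-- The group cochain `σ_k` associated to a weak `k`-moment map:
`σ_k(g)(p) = f_k(p) − Φ_{g⁻¹}^* f_k(Ad_{g⁻¹} p)`. -/
noncomputable def mmCocycle {n : ℤ} {C : PlecticAction n} {k : ℤ}
    (F : WeakMomentMap C k) (g : C.G) (p : ↥(C.LieKer k)) : C.Form :=
  F.f p - C.pullForm g⁻¹ (F.f (adAd C g⁻¹ k p))

end PlecticAction

open PlecticAction in
/-- **`σ_k` is a group `1`-cocycle.**
Let a connected Lie group `G` act multisymplectically on an `n`-plectic
manifold `(M,ω)`, let `f_k` be a weak `k`-moment map and define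
`σ_k(g)(p) := f_k(p) − Φ_{g⁻¹}^* f_k(Ad_{g⁻¹} p)`.  Then `σ_k` takes values
in `Ρ*_{𝔤,k} ⊗ Ω^{n−k}_cl(M)` (its values are closed `(n−k)`-forms) and it is
a `1`-cocycle for the differentiable group cohomology of `G` with these
coefficients: `σ_k(gh) = σ_k(g) + g·σ_k(h)` for all `g, h ∈ G`, where
`(g·α)(p) = Φ_{g⁻¹}^*(α(Ad_{g⁻¹} p))`. -/
theorem moment_map_cocycle {n : ℤ} (C : PlecticAction n)
    (k : ℤ) (F : WeakMomentMap C k) :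
    (∀ (g : C.G) (p : ↥(C.LieKer k)), C.d (mmCocycle F g p) = 0) ∧
    (∀ (g h : C.G) (p : ↥(C.LieKer k)),
      mmCocycle F (g * h) p
        = mmCocycle F g p + C.pullForm g⁻¹ (mmCocycle F h (adAd C g⁻¹ k p))) := by
  refine ⟨fun g p => ?_, fun g h p => ?_⟩
  · have hV : C.V (adAd C g⁻¹ k p : C.Λg) = C.pullMV g (C.V (p : C.Λg)) := by
      simpa [adAd] using C.V_Ad g⁻¹ (p : C.Λg)
    have hω : C.pullForm g⁻¹ (C.hook (C.pullMV g (C.V (p : C.Λg))) C.ω)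
        = C.hook (C.V (p : C.Λg)) C.ω := by
      conv_lhs => rw [← C.pullForm_omega g]
      rw [← C.pull_hook, ← C.pullForm_mul, mul_inv_cancel, C.pullForm_one]
    rw [mmCocycle, map_sub, ← C.pullForm_d, F.moment, F.moment, hV, map_smul, hω, sub_self]
  · have hAd : adAd C (g * h)⁻¹ k p = adAd C h⁻¹ k (adAd C g⁻¹ k p) :=
      Subtype.ext (by simp only [adAd, mul_inv_rev, C.AdΛ_mul])
    simp only [mmCocycle, hAd, map_sub]
    rw [mul_inv_rev, C.pullForm_mul]
    abel
end
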